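/- arXiv:1610.09216 — 2 statements merged into one kernel-verified Lean document; each statement's English description precedes it below -/
import Mathlib

section
/- Let Ω ⊂ ℝⁿ be open and bounded and 1 < p < ∞. Let f : Ω × ℝ × ℝⁿ → ℝ be uniformly continuous and satisfy the growth condition |f(x,s,η)| ≤ γ(|s|)|η|^{p−1} + φ₀(x) with γ : [0,∞) → [0,∞) continuous and φ₀ ∈ L^∞_loc(Ω). Let u : Ω → ℝ be bounded and locally Lipschitz, let u_ε be its infimal convolutions (with exponent q ≥ 2), and set f_ε(x,s,η) = inf_{y ∈ B_{r(ε)}(x)} f(y,s,η). If ∇u_ε converges to ∇u in L^p_loc(Ω), i.e. ∫_K |∇u_ε − ∇u|^p dx → 0 as ε → 0 for every compact K ⊂ Ω, then for every nonnegative ψ ∈ C_c^∞(Ω): lim_{ε→0} ∫_Ω f_ε(x, u_ε, ∇u_ε) ψ dx = ∫_Ω f(x, u, ∇u) ψ dx. -/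
open MeasureTheory Metric Set Filter
open scoped RealInnerProductSpace ENNReal Topology NNReal

noncomputable section

abbrev Euc (n : ℕ) := EuclideanSpace ℝ (Fin n)

variable {n : ℕ}

/-- The p-Laplacian `Δ_p φ (x) = |∇φ|^{p-2} ( Δφ + (p-2)|∇φ|^{-2} ⟨D²φ ∇φ, ∇φ⟩ )` of a C² function
at a point where the gradient does not vanish (junk value elsewhere). -/
def pLap (p : ℝ) (φ : Euc n → ℝ) (x : Euc n) : ℝ :=
  ‖gradient φ x‖ ^ (p - 2) *
    ((LinearMap.trace ℝ (Euc n)) (fderiv ℝ (gradient φ) x).toLinearMap +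
      ((p - 2) / ‖gradient φ x‖ ^ (2 : ℕ)) *
        ⟪(fderiv ℝ (gradient φ) x) (gradient φ x), gradient φ x⟫)

/-- `lim_{r → 0} sup_{x ∈ B_r(x₀) \ {x₀}} g(x)`, as a monotone limit in the extended reals. -/
def limsupPunct (g : Euc n → ℝ) (x₀ : Euc n) : EReal :=
  ⨅ (r : ℝ) (_ : 0 < r), ⨆ x ∈ ball x₀ r \ {x₀}, (g x : EReal)

/-- Viscosity supersolution of `-Δ_p u = f(x, u, ∇u)` in an open set `Ω`. -/
def IsViscositySupersolution (p : ℝ) (f : Euc n → ℝ → Euc n → ℝ) (Ω : Set (Euc n))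
    (u : Euc n → ℝ) : Prop :=
  ∀ x₀ ∈ Ω, ∀ φ : Euc n → ℝ, ContDiffOn ℝ 2 φ Ω →
    φ x₀ = u x₀ → (∀ x ∈ Ω, φ x ≤ u x) → (∀ x ∈ Ω, x ≠ x₀ → gradient φ x ≠ 0) →
    (f x₀ (u x₀) (gradient φ x₀) : EReal) ≤ limsupPunct (fun x => -pLap p φ x) x₀

/-- Viscosity subsolution: `-u` is a viscosity supersolution of `-Δ_p v = -f(x, -v, -∇v)`. -/
def IsViscositySubsolution (p : ℝ) (f : Euc n → ℝ → Euc n → ℝ) (Ω : Set (Euc n))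
    (u : Euc n → ℝ) : Prop :=
  IsViscositySupersolution p (fun x s η => -(f x (-s) (-η))) Ω (fun x => -(u x))

def IsViscositySolution (p : ℝ) (f : Euc n → ℝ → Euc n → ℝ) (Ω : Set (Euc n))
    (u : Euc n → ℝ) : Prop :=
  IsViscositySupersolution p f Ω u ∧ IsViscositySubsolution p f Ω u

/-- Weak (distributional) supersolution of `-Δ_p u = f(x, u, ∇u)` in `Ω`, where `gradient u` is
the a.e.-defined pointwise gradient. -/
def IsWeakSupersolution (p : ℝ) (f : Euc n → ℝ → Euc n → ℝ) (Ω : Set (Euc n))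
    (u : Euc n → ℝ) : Prop :=
  ∀ ψ : Euc n → ℝ, ContDiff ℝ (⊤ : ℕ∞) ψ → HasCompactSupport ψ → tsupport ψ ⊆ Ω → (∀ x, 0 ≤ ψ x) →
    ∫ x in Ω, f x (u x) (gradient u x) * ψ x ≤
      ∫ x in Ω, ‖gradient u x‖ ^ (p - 2) * ⟪gradient u x, gradient ψ x⟫

def IsWeakSubsolution (p : ℝ) (f : Euc n → ℝ → Euc n → ℝ) (Ω : Set (Euc n))
    (u : Euc n → ℝ) : Prop :=
  IsWeakSupersolution p (fun x s η => -(f x (-s) (-η))) Ω (fun x => -(u x))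

def IsWeakSolution (p : ℝ) (f : Euc n → ℝ → Euc n → ℝ) (Ω : Set (Euc n))
    (u : Euc n → ℝ) : Prop :=
  IsWeakSupersolution p f Ω u ∧ IsWeakSubsolution p f Ω u

/-- `f` is non-increasing in its second argument. -/
def NonincreasingInS (f : Euc n → ℝ → Euc n → ℝ) : Prop :=
  ∀ x η, ∀ s₁ s₂ : ℝ, s₁ ≤ s₂ → f x s₂ η ≤ f x s₁ η

/-- `φ₀ ∈ L^∞_loc(Ω)`. -/
def LocEssBddOn (φ₀ : Euc n → ℝ) (Ω : Set (Euc n)) : Prop :=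
  ∀ x ∈ Ω, ∃ t ∈ 𝓝 x, ∃ C : ℝ, ∀ᵐ y ∂(volume : Measure (Euc n)), y ∈ t → |φ₀ y| ≤ C

/-- `f` is locally Lipschitz continuous with respect to its third variable `η`. -/
def LocLipschitzInEta (f : Euc n → ℝ → Euc n → ℝ) (Ω : Set (Euc n)) : Prop :=
  ∀ x ∈ Ω, ∀ s : ℝ, ∀ η₀ : Euc n, ∃ ε > 0, ∃ K : ℝ,
    ∀ η₁ ∈ ball η₀ ε, ∀ η₂ ∈ ball η₀ ε, |f x s η₁ - f x s η₂| ≤ K * ‖η₁ - η₂‖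

/-- The oscillation `sup_Ω u - inf_Ω u`. -/
def oscOn (u : Euc n → ℝ) (Ω : Set (Euc n)) : ℝ := sSup (u '' Ω) - sInf (u '' Ω)

/-- The infimal convolution `u_ε(x) = inf_{y ∈ Ω} ( u(y) + |x-y|^q / (q ε^{q-1}) )`. -/
def infConv (u : Euc n → ℝ) (Ω : Set (Euc n)) (q ε : ℝ) (x : Euc n) : ℝ :=
  ⨅ y : Ω, (u y + ‖x - (y : Euc n)‖ ^ q / (q * ε ^ (q - 1)))

/-- The radius `r(ε) = ( q ε^{q-1} ( osc_Ω u + 1 ) )^{1/q}`. -/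
def rEps (u : Euc n → ℝ) (Ω : Set (Euc n)) (q ε : ℝ) : ℝ :=
  (q * ε ^ (q - 1) * (oscOn u Ω + 1)) ^ (1 / q)

/-- `f_r(x, s, η) = inf_{y ∈ B_r(x)} f(y, s, η)`. -/
def fEps (f : Euc n → ℝ → Euc n → ℝ) (r : ℝ) (x : Euc n) (s : ℝ) (η : Euc n) : ℝ :=
  ⨅ y : ball x r, f (y : Euc n) s η


lemma ciInf_le_ciInf_add {ι κ : Type*} [Nonempty ι] {a : ι → ℝ} {b : κ → ℝ} {c : ℝ}
    (hb : BddBelow (range b)) (h : ∀ i, ∃ j, b j ≤ a i + c) : ⨅ j, b j ≤ (⨅ i, a i) + c := by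
  rw [← sub_le_iff_le_add]
  refine le_ciInf fun i => ?_
  obtain ⟨j, hj⟩ := h i
  linarith [ciInf_le hb j]

/-- A function on a normed space with a modulus of continuity at one scale has linear growth of
its increments. -/
lemma abs_sub_le_of_modulus {E : Type*} [NormedAddCommGroup E] [NormedSpace ℝ E] {g : E → ℝ}
    {ρ δ : ℝ} (hρ : 0 < ρ) (hδ : 0 ≤ δ) (h : ∀ a b, ‖a - b‖ < ρ → |g a - g b| ≤ δ) (a b : E) :
    |g a - g b| ≤ δ * (‖a - b‖ / ρ + 1) := by
  have key : ∀ N : ℕ, ∀ a b, ‖a - b‖ < (N + 1) * ρ → |g a - g b| ≤ (N + 1) * δ := by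
    intro N
    induction N with
    | zero => intro a b hab; simpa using h a b (by simpa using hab)
    | succ N ih =>
      intro a b hab
      push_cast at hab ⊢
      have hN : (0 : ℝ) < N + 1 + 1 := by positivity
      set c := AffineMap.lineMap (k := ℝ) a b (1 / ((N : ℝ) + 1 + 1)) with hc
      have h1 : ‖a - c‖ = ‖a - b‖ / (N + 1 + 1) := by
        rw [← dist_eq_norm, hc, dist_left_lineMap, dist_eq_norm, Real.norm_of_nonneg (by positivity)]
        ring
      have h2 : ‖c - b‖ = ‖a - b‖ / (N + 1 + 1) * (N + 1) := by
        rw [← dist_eq_norm, hc, dist_lineMap_right, dist_eq_norm]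
        have : 1 - 1 / ((N : ℝ) + 1 + 1) = (N + 1) / (N + 1 + 1) := by field_simp; ring
        rw [this, Real.norm_of_nonneg (by positivity)]
        ring
      have h3 : ‖a - b‖ / (N + 1 + 1) < ρ := by
        rw [div_lt_iff₀ hN]; linarith
      have h4 := h a c (by rw [h1]; exact h3)
      have h5 := ih c b (by rw [h2, mul_comm]; gcongr)
      have h6 := abs_sub_le (g a) (g c) (g b)
      linarith
  have ht : 0 ≤ ‖a - b‖ / ρ := by positivity
  have h1 := key ⌊‖a - b‖ / ρ⌋₊ a b (by
    rw [← div_lt_iff₀ hρ]; exact Nat.lt_floor_add_one _)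
  have h2 := Nat.floor_le ht
  nlinarith

lemma UniformContinuousOn.exists_modulus {Ω : Set (Euc n)} {f : Euc n → ℝ → Euc n → ℝ}
    (hf : UniformContinuousOn (fun w : Euc n × ℝ × Euc n => f w.1 w.2.1 w.2.2)
      (Ω ×ˢ (univ : Set ℝ) ×ˢ (univ : Set (Euc n)))) {δ : ℝ} (hδ : 0 < δ) :
    ∃ ρ > 0, ∀ x ∈ Ω, ∀ x' ∈ Ω, ∀ s s' η η', dist x x' < ρ → |s - s'| < ρ → ‖η - η'‖ < ρ →
      |f x s η - f x' s' η'| < δ := by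
  obtain ⟨ρ, hρ, h⟩ := Metric.uniformContinuousOn_iff.1 hf δ hδ
  refine ⟨ρ, hρ, fun x hx x' hx' s s' η η' h1 h2 h3 => ?_⟩
  have := h (x, s, η) (by simp [hx]) (x', s', η') (by simp [hx'])
    (by simp only [Prod.dist_eq, max_lt_iff, Real.dist_eq, dist_eq_norm η]; exact ⟨h1, h2, h3⟩)
  simpa [Real.dist_eq] using this

lemma abs_fEps_sub_le {f : Euc n → ℝ → Euc n → ℝ} {r δ s : ℝ} {x η : Euc n} (hr : 0 < r)
    (h : ∀ y ∈ ball x r, |f y s η - f x s η| ≤ δ) : |fEps f r x s η - f x s η| ≤ δ := by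
  have hne : Nonempty (ball x r) := ⟨⟨x, mem_ball_self hr⟩⟩
  have hlow : f x s η - δ ≤ fEps f r x s η :=
    le_ciInf fun y => by linarith [(abs_le.1 (h y y.2)).1]
  have hbdd : BddBelow (range fun y : ball x r => f (y : Euc n) s η) := by
    refine ⟨f x s η - δ, ?_⟩
    rintro _ ⟨y, rfl⟩
    have := (abs_le.1 (h y y.2)).1
    dsimp only
    linarith
  have hup : fEps f r x s η ≤ f x s η := ciInf_le hbdd ⟨x, mem_ball_self hr⟩
  have hδ : 0 ≤ δ := (abs_nonneg _).trans (h x (mem_ball_self hr))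
  rw [abs_le]
  constructor <;> linarith

lemma continuousOn_fEps {Ω K : Set (Euc n)} {f : Euc n → ℝ → Euc n → ℝ}
    (hf : UniformContinuousOn (fun w : Euc n × ℝ × Euc n => f w.1 w.2.1 w.2.2)
      (Ω ×ˢ (univ : Set ℝ) ×ˢ (univ : Set (Euc n)))) {r : ℝ} (hr : 0 < r)
    (hK : ∀ x ∈ K, ball x r ⊆ Ω)
    (hbdd : ∀ x ∈ K, ∀ s η, BddBelow (range fun y : ball x r => f (y : Euc n) s η)) :
    ContinuousOn (fun w : Euc n × ℝ × Euc n => fEps f r w.1 w.2.1 w.2.2)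
      (K ×ˢ (univ : Set ℝ) ×ˢ (univ : Set (Euc n))) := by
  refine UniformContinuousOn.continuousOn (Metric.uniformContinuousOn_iff.2 fun δ hδ => ?_)
  obtain ⟨ρ, hρ, h⟩ := hf.exists_modulus (half_pos hδ)
  have one_side : ∀ x ∈ K, ∀ x' ∈ K, ∀ s s' η η', dist x x' < ρ → |s - s'| < ρ → ‖η - η'‖ < ρ →
      fEps f r x' s' η' ≤ fEps f r x s η + δ / 2 := by
    intro x hx x' hx' s s' η η' h1 h2 h3
    have hne : Nonempty (ball x r) := ⟨⟨x, mem_ball_self hr⟩⟩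
    refine ciInf_le_ciInf_add (hbdd x' hx' s' η') fun y => ?_
    have hy : (y : Euc n) + (x' - x) ∈ ball x' r := by
      have := y.2
      rw [mem_ball, dist_eq_norm] at this ⊢
      rwa [show (y : Euc n) + (x' - x) - x' = y - x by abel]
    refine ⟨⟨_, hy⟩, ?_⟩
    have hd : dist (y : Euc n) ((y : Euc n) + (x' - x)) < ρ := by
      rw [dist_self_add_right, ← dist_eq_norm, dist_comm]; exact h1
    have := h y (hK x hx y.2) _ (hK x' hx' hy) s s' η η' hd h2 h3
    linarith [(abs_lt.1 this).1]
  refine ⟨ρ, hρ, ?_⟩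
  rintro ⟨x, s, η⟩ hx ⟨x', s', η'⟩ hx' hd
  simp only [mem_prod, mem_univ, and_true] at hx hx'
  simp only [Prod.dist_eq, max_lt_iff, Real.dist_eq, dist_eq_norm η] at hd
  have h1 := one_side x hx x' hx' s s' η η' hd.1 hd.2.1 hd.2.2
  have h2 := one_side x' hx' x hx s' s η' η (by rw [dist_comm]; exact hd.1)
    (by rw [abs_sub_comm]; exact hd.2.1) (by rw [norm_sub_rev]; exact hd.2.2)
  rw [Real.dist_eq, abs_lt]
  constructor <;> dsimp only <;> linarith

lemma abs_rpow_sub_rpow_le {q T a b : ℝ} (hq : 1 ≤ q) (ha : a ∈ Icc 0 T) (hb : b ∈ Icc 0 T) :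
    |a ^ q - b ^ q| ≤ q * T ^ (q - 1) * |a - b| := by
  refine (convex_Icc 0 T).norm_image_sub_le_of_norm_hasDerivWithin_le
    (f := fun t : ℝ => t ^ q) (f' := fun t => q * t ^ (q - 1))
    (fun t _ => (Real.hasDerivAt_rpow_const (Or.inr hq)).hasDerivWithinAt) (fun t ht => ?_) hb ha
  have ht0 : 0 ≤ t := ht.1
  rw [Real.norm_of_nonneg (by positivity)]
  have := Real.rpow_le_rpow ht.1 ht.2 (sub_nonneg.2 hq)
  gcongr

lemma bddBelow_infConv {Ω : Set (Euc n)} {u : Euc n → ℝ} {C q ε : ℝ} (hu : ∀ x ∈ Ω, |u x| ≤ C)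
    (hq : 0 < q) (hε : 0 < ε) (x : Euc n) :
    BddBelow (range fun y : Ω => u y + ‖x - (y : Euc n)‖ ^ q / (q * ε ^ (q - 1))) := by
  refine ⟨-C, ?_⟩
  rintro _ ⟨y, rfl⟩
  have h1 := (abs_le.1 (hu y y.2)).1
  have h2 : 0 ≤ ‖x - (y : Euc n)‖ ^ q / (q * ε ^ (q - 1)) := by positivity
  dsimp only
  linarith

lemma locallyLipschitzOn_infConv {Ω : Set (Euc n)} (hΩb : Bornology.IsBounded Ω)
    {u : Euc n → ℝ} {C q ε : ℝ} (hu : ∀ x ∈ Ω, |u x| ≤ C) (hq : 1 ≤ q) (hε : 0 < ε) :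
    LocallyLipschitzOn Ω (infConv u Ω q ε) := by
  have hq0 : 0 < q := by linarith
  obtain ⟨T, hT⟩ := Metric.isBounded_iff.1 hΩb
  have hden : 0 < q * ε ^ (q - 1) := by positivity
  suffices h : LipschitzOnWith (q * T ^ (q - 1) / (q * ε ^ (q - 1))).toNNReal
      (infConv u Ω q ε) Ω from fun x _ => ⟨_, Ω, self_mem_nhdsWithin, h⟩
  refine LipschitzOnWith.of_le_add_mul' _ fun x hx x' hx' => ?_
  have hne : Nonempty Ω := ⟨⟨x, hx⟩⟩
  refine ciInf_le_ciInf_add (bddBelow_infConv hu hq0 hε x) fun y => ⟨y, ?_⟩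
  have h1 : ‖x - (y : Euc n)‖ ∈ Icc 0 T :=
    ⟨norm_nonneg _, by rw [← dist_eq_norm]; exact hT hx y.2⟩
  have h2 : ‖x' - (y : Euc n)‖ ∈ Icc 0 T :=
    ⟨norm_nonneg _, by rw [← dist_eq_norm]; exact hT hx' y.2⟩
  have hT0 : 0 ≤ T := h1.1.trans h1.2
  have h3 := (le_abs_self _).trans (abs_rpow_sub_rpow_le hq h1 h2)
  have h4 : |‖x - (y : Euc n)‖ - ‖x' - (y : Euc n)‖| ≤ dist x x' := by
    have := abs_norm_sub_norm_le (x - (y : Euc n)) (x' - y)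
    rwa [sub_sub_sub_cancel_right, ← dist_eq_norm] at this
  have h5 : ‖x - (y : Euc n)‖ ^ q ≤ ‖x' - (y : Euc n)‖ ^ q + q * T ^ (q - 1) * dist x x' := by
    have := mul_le_mul_of_nonneg_left h4 (show 0 ≤ q * T ^ (q - 1) by positivity)
    linarith
  have h6 := div_le_div_of_nonneg_right h5 hden.le
  rw [add_div, mul_div_right_comm] at h6
  linarith

lemma LocallyLipschitzOn.exists_norm_gradient_le {Ω K : Set (Euc n)} (hΩ : IsOpen Ω)
    {v : Euc n → ℝ} (hv : LocallyLipschitzOn Ω v) (hK : IsCompact K) (hKΩ : K ⊆ Ω) :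
    ∃ C, ∀ x ∈ K, ‖gradient v x‖ ≤ C := by
  refine hK.induction_on (p := fun s => ∃ C, ∀ x ∈ s, ‖gradient v x‖ ≤ C) ⟨0, by simp⟩
    (fun s t hst ⟨C, hC⟩ => ⟨C, fun x hx => hC x (hst hx)⟩) ?_ ?_
  · rintro s t ⟨C, hC⟩ ⟨D, hD⟩
    refine ⟨max C D, fun x hx => hx.elim (fun h => ?_) fun h => ?_⟩
    · exact (hC x h).trans (le_max_left _ _)
    · exact (hD x h).trans (le_max_right _ _)
  · intro x hx
    obtain ⟨L, t, ht, hL⟩ := hv (hKΩ hx)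
    rw [hΩ.nhdsWithin_eq (hKΩ hx)] at ht
    refine ⟨interior t, mem_nhdsWithin_of_mem_nhds (interior_mem_nhds.2 ht), L, fun y hy => ?_⟩
    rw [gradient, LinearIsometryEquiv.norm_map]
    exact norm_fderiv_le_of_lipschitzOn ℝ (mem_interior_iff_mem_nhds.1 hy) hL

lemma measurable_gradient (v : Euc n → ℝ) : Measurable (gradient v) :=
  (InnerProductSpace.toDual ℝ (Euc n)).symm.continuous.measurable.comp (measurable_fderiv ℝ v)

lemma tendsto_const_mul_rpow_zero {q : ℝ} (hq : 1 < q) (c : ℝ) :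
    Tendsto (fun ε : ℝ => q * ε ^ (q - 1) * c) (𝓝[>] 0) (𝓝 0) := by
  have h : ContinuousAt (fun ε : ℝ => q * ε ^ (q - 1) * c) 0 :=
    ((Real.continuousAt_rpow_const 0 (q - 1) (Or.inr (by linarith))).const_mul q).mul_const c
  have h' : Tendsto _ _ _ := h
  simp only [Real.zero_rpow (show q - 1 ≠ 0 by linarith), mul_zero, zero_mul] at h'
  exact h'.mono_left nhdsWithin_le_nhds

lemma oscOn_nonneg {Ω : Set (Euc n)} {u : Euc n → ℝ} {C : ℝ}
    (hu : ∀ x ∈ Ω, |u x| ≤ C) : 0 ≤ oscOn u Ω := by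
  refine sub_nonneg.2 (Real.sInf_le_sSup _ ⟨-C, ?_⟩ ⟨C, ?_⟩)
  · rintro _ ⟨x, hx, rfl⟩; exact (abs_le.1 (hu x hx)).1
  · rintro _ ⟨x, hx, rfl⟩; exact (abs_le.1 (hu x hx)).2

lemma tendsto_rEps {q : ℝ} (hq : 1 < q) (u : Euc n → ℝ) (Ω : Set (Euc n)) :
    Tendsto (rEps u Ω q) (𝓝[>] 0) (𝓝 0) := by
  have h0 : (0 : ℝ) < 1 / q := by positivity
  have h := (tendsto_const_mul_rpow_zero hq (oscOn u Ω + 1)).rpow_const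
    (p := 1 / q) (Or.inr h0.le)
  rwa [Real.zero_rpow h0.ne'] at h

lemma eventually_abs_infConv_sub_lt {Ω K : Set (Euc n)} (hΩ : IsOpen Ω) {u : Euc n → ℝ} {C q : ℝ}
    (hu : ∀ x ∈ Ω, |u x| ≤ C) (huc : ContinuousOn u Ω) (hq : 1 < q) (hK : IsCompact K)
    (hKΩ : K ⊆ Ω) {δ : ℝ} (hδ : 0 < δ) :
    ∀ᶠ ε in 𝓝[>] (0 : ℝ), ∀ x ∈ K, |infConv u Ω q ε x - u x| < δ := by
  have hq0 : 0 < q := by linarith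
  obtain ⟨ρ, hρ, h⟩ := Metric.mem_uniformity_dist.1 (hK.uniformContinuousAt_of_continuousAt u
    (fun x hx => huc.continuousAt (hΩ.mem_nhds (hKΩ hx))) (Metric.dist_mem_uniformity (half_pos hδ)))
  have hρq : 0 < ρ ^ q := by positivity
  filter_upwards [(tendsto_const_mul_rpow_zero hq (2 * C)).eventually (gt_mem_nhds hρq),
    self_mem_nhdsWithin] with ε hε hε0 x hx
  have hε0 : 0 < ε := hε0
  have hxΩ := hKΩ hx
  have hden : 0 < q * ε ^ (q - 1) := by positivity
  have hne : Nonempty Ω := ⟨⟨x, hxΩ⟩⟩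
  have hup : infConv u Ω q ε x ≤ u x := by
    refine (ciInf_le (bddBelow_infConv hu hq0 hε0 x) ⟨x, hxΩ⟩).trans ?_
    simp [Real.zero_rpow hq0.ne']
  have hlow : u x - δ / 2 ≤ infConv u Ω q ε x := by
    refine le_ciInf fun y => ?_
    have hnn : 0 ≤ ‖x - (y : Euc n)‖ ^ q / (q * ε ^ (q - 1)) := by positivity
    rcases lt_or_ge (dist x (y : Euc n)) ρ with hd | hd
    · have : dist (u x) (u y) < δ / 2 := h hd hx
      rw [Real.dist_eq] at this
      linarith [(abs_lt.1 this).2]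
    · have h1 : 2 * C ≤ ‖x - (y : Euc n)‖ ^ q / (q * ε ^ (q - 1)) := by
        rw [le_div_iff₀ hden, ← dist_eq_norm]
        have := Real.rpow_le_rpow hρ.le hd hq0.le
        linarith
      linarith [(abs_le.1 (hu y y.2)).1, (abs_le.1 (hu x hxΩ)).2]
  rw [abs_lt]
  constructor <;> linarith

lemma aestronglyMeasurable_comp_gradient {K : Set (Euc n)} (hK : MeasurableSet K)
    {G : Euc n × ℝ × Euc n → ℝ} (hG : ContinuousOn G (K ×ˢ (univ : Set ℝ) ×ˢ (univ : Set (Euc n))))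
    {v : Euc n → ℝ} (hv : ContinuousOn v K) :
    AEStronglyMeasurable (fun x => G (x, v x, gradient v x)) (volume.restrict K) := by
  refine (aemeasurable_restrict_of_measurable_subtype hK ?_).aestronglyMeasurable
  have hm : Measurable fun x : K => ((x : Euc n), v x, gradient v x) :=
    measurable_subtype_coe.prodMk ((continuousOn_iff_continuous_domRestrict.1 hv).measurable.prodMk
      ((measurable_gradient v).comp measurable_subtype_coe))
  have hm' : Measurable fun x : K =>
      (⟨((x : Euc n), v x, gradient v x), by simp⟩ :
        (K ×ˢ (univ : Set ℝ) ×ˢ (univ : Set (Euc n)) : Set (Euc n × ℝ × Euc n))) :=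
    hm.subtype_mk
  exact (continuousOn_iff_continuous_domRestrict.1 hG).measurable.comp hm'

/-- **Lemma 2.2.** Weak convergence of the lower order terms along infimal convolutions:
if `∇u_ε → ∇u` in `L^p_loc(Ω)` then `∫ f_ε(x, u_ε, ∇u_ε) ψ → ∫ f(x, u, ∇u) ψ` for every
nonnegative test function `ψ`. -/
theorem convergence_of_lower_order_terms
    (n : ℕ) (Ω : Set (Euc n)) (hΩo : IsOpen Ω) (hΩb : Bornology.IsBounded Ω)
    (p : ℝ) (hp : 1 < p)
    (f : Euc n → ℝ → Euc n → ℝ)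
    (hfuc : UniformContinuousOn (fun w : Euc n × ℝ × Euc n => f w.1 w.2.1 w.2.2)
      (Ω ×ˢ (univ : Set ℝ) ×ˢ (univ : Set (Euc n))))
    (γ : ℝ → ℝ) (hγc : ContinuousOn γ (Ici 0)) (hγnn : ∀ t ∈ Ici (0 : ℝ), 0 ≤ γ t)
    (φ₀ : Euc n → ℝ) (hφ₀ : LocEssBddOn φ₀ Ω)
    (hgrowth : ∀ x ∈ Ω, ∀ (s : ℝ) (η : Euc n), |f x s η| ≤ γ |s| * ‖η‖ ^ (p - 1) + φ₀ x)
    (u : Euc n → ℝ) (hubdd : ∃ C, ∀ x ∈ Ω, |u x| ≤ C) (huLip : LocallyLipschitzOn Ω u)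
    (q : ℝ) (hq : 2 ≤ q)
    (hconv : ∀ K : Set (Euc n), IsCompact K → K ⊆ Ω →
      Tendsto (fun ε => ∫ x in K, ‖gradient (infConv u Ω q ε) x - gradient u x‖ ^ p)
        (𝓝[>] (0 : ℝ)) (𝓝 0))
    (ψ : Euc n → ℝ) (hψ : ContDiff ℝ (⊤ : ℕ∞) ψ) (hψsupp : HasCompactSupport ψ)
    (hψΩ : tsupport ψ ⊆ Ω) (hψnn : ∀ x, 0 ≤ ψ x) :
    Tendsto (fun ε => ∫ x in Ω,
        fEps f (rEps u Ω q ε) x (infConv u Ω q ε x) (gradient (infConv u Ω q ε) x) * ψ x)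
      (𝓝[>] (0 : ℝ)) (𝓝 (∫ x in Ω, f x (u x) (gradient u x) * ψ x)) := by
  obtain ⟨C, hu⟩ := hubdd
  have hq1 : 1 < q := by linarith
  set K := tsupport ψ with hKdef
  have hK : IsCompact K := hψsupp
  have hKm : MeasurableSet K := hK.isClosed.measurableSet
  have huc : ContinuousOn u Ω := huLip.continuousOn
  have hrestrict : ∀ h : Euc n → ℝ, ∫ x in Ω, h x * ψ x = ∫ x in K, h x * ψ x := fun h =>
    setIntegral_eq_of_subset_of_forall_sdiff_eq_zero hΩo.measurableSet hψΩ fun x hx => by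
      rw [image_eq_zero_of_notMem_tsupport hx.2, mul_zero]
  simp only [hrestrict]
  obtain ⟨M, hM⟩ := hψsupp.exists_bound_of_continuous hψ.continuous
  have hM0 : 0 ≤ M := (norm_nonneg _).trans (hM 0)
  have hfin : IsFiniteMeasure (volume.restrict K : Measure (Euc n)) :=
    isFiniteMeasure_restrict.2 hK.measure_lt_top.ne
  obtain ⟨D, hD⟩ := huLip.exists_norm_gradient_le hΩo hK hψΩ
  have hψm : AEStronglyMeasurable ψ (volume.restrict K) := hψ.continuous.aestronglyMeasurable
  have hlimit : Integrable (fun x => f x (u x) (gradient u x) * ψ x) (volume.restrict K) := by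
    have hmeas := aestronglyMeasurable_comp_gradient hKm
      (hfuc.continuousOn.mono (prod_mono_left hψΩ)) (huc.mono hψΩ)
    obtain ⟨B, hB⟩ := (hK.prod ((isCompact_closedBall (0 : ℝ) C).prod
      (isCompact_closedBall (0 : Euc n) D))).exists_bound_of_continuousOn
      (hfuc.continuousOn.mono (prod_mono hψΩ (prod_mono (subset_univ _) (subset_univ _))))
    refine (Integrable.of_bound hmeas B ?_).mul_bdd (c := M) hψm (ae_of_all _ hM)
    refine ae_restrict_of_forall_mem hKm fun x hx => hB (x, u x, gradient u x) ⟨hx, ?_, ?_⟩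
    · simpa using hu x (hψΩ hx)
    · simpa using hD x hx
  obtain ⟨R, hR, hRΩ⟩ := hK.exists_thickening_subset_open hΩo hψΩ
  rw [Metric.tendsto_nhds]
  intro e he
  set V := (volume.restrict K : Measure (Euc n)).real univ with hV
  have hV0 : 0 ≤ V := measureReal_nonneg
  obtain ⟨δ, hδ, hδe⟩ : ∃ δ > 0, M * (δ * (4 * V + 1)) < e := by
    have hA : 0 ≤ M * (4 * V + 1) := by positivity
    refine ⟨e / (M * (4 * V + 1) + 1), by positivity, ?_⟩
    rw [show M * (e / (M * (4 * V + 1) + 1) * (4 * V + 1))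
      = e * (M * (4 * V + 1)) / (M * (4 * V + 1) + 1) by ring, div_lt_iff₀ (by positivity)]
    nlinarith
  obtain ⟨ρ, hρ, hmod⟩ := hfuc.exists_modulus hδ
  have hρp : 0 < ρ ^ p := by positivity
  filter_upwards [(hconv K hK hψΩ).eventually (gt_mem_nhds hρp),
    eventually_abs_infConv_sub_lt hΩo hu huc hq1 hK hψΩ hρ,
    (tendsto_rEps hq1 u Ω).eventually (gt_mem_nhds hρ),
    (tendsto_rEps hq1 u Ω).eventually (gt_mem_nhds hR), self_mem_nhdsWithin]
    with ε hgrad huε hrρ hrR hε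
  have hε : 0 < ε := hε
  have hr : 0 < rEps u Ω q ε := by
    have := oscOn_nonneg hu
    unfold rEps
    positivity
  set r := rEps u Ω q ε
  set v := infConv u Ω q ε
  have hball : ∀ x ∈ K, ball x r ⊆ Ω := fun x hx y hy =>
    hRΩ (mem_thickening_iff.2 ⟨x, hx, lt_trans hy hrR⟩)
  have hosc : ∀ x ∈ K, ∀ s η, ∀ y ∈ ball x r, |f y s η - f x s η| ≤ δ := fun x hx s η y hy =>
    (hmod y (hball x hx hy) x (hψΩ hx) s s η η (lt_trans hy hrρ) (by simpa) (by simpa)).le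
  have hvLip : LocallyLipschitzOn Ω v := locallyLipschitzOn_infConv hΩb hu hq1.le hε
  have hmeas : AEStronglyMeasurable (fun x => fEps f r x (v x) (gradient v x))
      (volume.restrict K) := by
    refine aestronglyMeasurable_comp_gradient (G := fun w => fEps f r w.1 w.2.1 w.2.2) hKm
      (continuousOn_fEps hfuc hr hball fun x hx s η => ⟨f x s η - δ, ?_⟩)
      (hvLip.continuousOn.mono hψΩ)
    rintro _ ⟨y, rfl⟩
    have := (abs_le.1 (hosc x hx s η y y.2)).1
    dsimp only
    linarith
  have hpoint : ∀ x ∈ K, |fEps f r x (v x) (gradient v x) - f x (u x) (gradient u x)| ≤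
      δ * (4 + ‖gradient v x - gradient u x‖ ^ p / ρ ^ p) := by
    intro x hx
    have h1 := abs_fEps_sub_le hr (hosc x hx (v x) (gradient v x))
    have h2 := (hmod x (hψΩ hx) x (hψΩ hx) (v x) (u x) (gradient v x) (gradient v x)
      (by simpa) (huε x hx) (by simpa)).le
    have h3 := abs_sub_le_of_modulus (g := f x (u x)) hρ hδ.le
      (fun a b hab => (hmod x (hψΩ hx) x (hψΩ hx) (u x) (u x) a b (by simpa) (by simpa) hab).le)
      (gradient v x) (gradient u x)
    have ht0 : 0 ≤ ‖gradient v x - gradient u x‖ / ρ := by positivity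
    have h4 : ‖gradient v x - gradient u x‖ / ρ ≤
        1 + ‖gradient v x - gradient u x‖ ^ p / ρ ^ p := by
      rw [← Real.div_rpow (norm_nonneg _) hρ.le]
      rcases le_total (‖gradient v x - gradient u x‖ / ρ) 1 with h | h
      · linarith [Real.rpow_nonneg ht0 p]
      · linarith [Real.self_le_rpow_of_one_le h hp.le]
    have h5 := abs_sub_le (fEps f r x (v x) (gradient v x)) (f x (v x) (gradient v x))
      (f x (u x) (gradient u x))
    have h6 := abs_sub_le (f x (v x) (gradient v x)) (f x (u x) (gradient v x))
      (f x (u x) (gradient u x))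
    have h7 := mul_le_mul_of_nonneg_left h4 hδ.le
    linarith
  have hpow : Integrable (fun x => ‖gradient v x - gradient u x‖ ^ p) (volume.restrict K) := by
    obtain ⟨D', hD'⟩ := hvLip.exists_norm_gradient_le hΩo hK hψΩ
    refine Integrable.of_bound ((((measurable_gradient v).sub (measurable_gradient u)).norm.pow_const
      p).aestronglyMeasurable) ((D' + D) ^ p) (ae_restrict_of_forall_mem hKm fun x hx => ?_)
    rw [Real.norm_of_nonneg (by positivity)]
    exact Real.rpow_le_rpow (norm_nonneg _)
      ((norm_sub_le _ _).trans (add_le_add (hD' x hx) (hD x hx))) (by linarith)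
  have hbound : Integrable (fun x => M * (δ * (4 + ‖gradient v x - gradient u x‖ ^ p / ρ ^ p)))
      (volume.restrict K) :=
    (((integrable_const 4).add (hpow.div_const _)).const_mul δ).const_mul M
  have hle : ∀ᵐ x ∂(volume.restrict K), ‖fEps f r x (v x) (gradient v x) * ψ x -
      f x (u x) (gradient u x) * ψ x‖ ≤
        M * (δ * (4 + ‖gradient v x - gradient u x‖ ^ p / ρ ^ p)) := by
    refine ae_restrict_of_forall_mem hKm fun x hx => ?_
    rw [← sub_mul, norm_mul, mul_comm]
    exact mul_le_mul (hM x) (hpoint x hx) (norm_nonneg _) hM0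
  have hdiff : Integrable (fun x => fEps f r x (v x) (gradient v x) * ψ x -
      f x (u x) (gradient u x) * ψ x) (volume.restrict K) :=
    hbound.mono' ((hmeas.mul hψm).sub hlimit.aestronglyMeasurable) hle
  have happrox : Integrable (fun x => fEps f r x (v x) (gradient v x) * ψ x)
      (volume.restrict K) := by
    exact (hdiff.add hlimit).congr (ae_of_all _ fun x => sub_add_cancel _ _)
  rw [dist_eq_norm, ← integral_sub happrox hlimit]
  refine (norm_integral_le_of_norm_le hbound hle).trans_lt (lt_of_le_of_lt ?_ hδe)
  rw [integral_const_mul, integral_const_mul, integral_add (integrable_const 4)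
    (hpow.div_const _), integral_div, integral_const, smul_eq_mul, mul_comm _ (4 : ℝ)]
  have := ((div_lt_one hρp).2 hgrad).le
  gcongr

end
end

section
/- Let 1 < p < ∞, let q ≥ 2 satisfy q > p/(p−1), let ε > 0, x̂ ∈ ℝⁿ and c ∈ ℝ, and define ψ(y) := c − |y − x̂|^q/(q ε^{q−1}). Then ψ is C² on ℝⁿ, ∇ψ(y) ≠ 0 for every y ≠ x̂, and lim_{r→0⁺} sup_{y ∈ B_r(x̂)∖{x̂}} |Δ_p ψ(y)| = 0; in particular lim_{r→0⁺} sup_{y ∈ B_r(x̂)∖{x̂}} (−Δ_p ψ(y)) = 0. -/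
open MeasureTheory Metric Set Filter
open scoped RealInnerProductSpace ENNReal Topology NNReal

noncomputable section

variable {n : ℕ}

section NormRpowSmul

variable {E : Type*} [NormedAddCommGroup E] [InnerProductSpace ℝ E]

/-- The derivative of the radial field `x ↦ ‖x‖ ^ s • x`. -/
def normRpowSmulDeriv (s : ℝ) (x : E) : E →L[ℝ] E :=
  ‖x‖ ^ s • ContinuousLinearMap.id ℝ E + (s * ‖x‖ ^ (s - 2)) • (innerSL ℝ x).smulRight x

lemma hasFDerivAt_norm_rpow_of_ne_zero (s : ℝ) {x : E} (hx : x ≠ 0) :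
    HasFDerivAt (fun x : E => ‖x‖ ^ s) ((s * ‖x‖ ^ (s - 2)) • innerSL ℝ x) x := by
  apply HasStrictFDerivAt.hasFDerivAt
  convert! (hasStrictFDerivAt_norm_sq x).rpow_const (p := s / 2) (by simp [hx]) using 0
  simp_rw [← Real.rpow_natCast_mul (norm_nonneg _), ← Nat.cast_smul_eq_nsmul ℝ, smul_smul]
  ring_nf

lemma norm_rpow_sub_two_mul_sq {F : Type*} [NormedAddCommGroup F] (s : ℝ) {x : F} (hx : x ≠ 0) :
    ‖x‖ ^ (s - 2) * ‖x‖ ^ 2 = ‖x‖ ^ s := by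
  rw [← Real.rpow_natCast, ← Real.rpow_add (norm_pos_iff.mpr hx)]
  norm_num

lemma tendsto_norm_rpow_zero {F : Type*} [SeminormedAddCommGroup F] {s : ℝ} (hs : 0 < s) :
    Tendsto (fun x : F => ‖x‖ ^ s) (𝓝 0) (𝓝 0) := by
  have h : ContinuousAt (fun x : F => ‖x‖ ^ s) 0 :=
    continuousAt_id.norm.rpow_const (.inr hs.le)
  simpa [ContinuousAt, hs.ne'] using h

lemma hasFDerivAt_norm_rpow_smul {s : ℝ} (hs : 0 ≤ s) (x : E) :
    HasFDerivAt (fun x : E => ‖x‖ ^ s • x) (normRpowSmulDeriv s x) x := by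
  rcases hs.eq_or_lt with rfl | hs
  · simpa [normRpowSmulDeriv, Function.id_def] using hasFDerivAt_id x
  by_cases hx : x = 0
  · subst hx
    have hD : normRpowSmulDeriv s (0 : E) = 0 := by
      simp [normRpowSmulDeriv, hs.ne']
    rw [hD]
    refine .of_isLittleO ?_
    have h : (fun x : E => ‖x‖ ^ s • x) =o[𝓝 0] fun x : E => (1 : ℝ) • x :=
      ((Asymptotics.isLittleO_const_iff one_ne_zero).mpr
        (tendsto_norm_rpow_zero hs)).smul_isBigO (Asymptotics.isBigO_refl _ _)
    simpa using h
  · convert! (hasFDerivAt_norm_rpow_of_ne_zero s hx).smul (hasFDerivAt_id x) using 1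
    ext v
    simp [normRpowSmulDeriv, smul_smul]

lemma continuous_normRpowSmulDeriv {s : ℝ} (hs : 0 ≤ s) :
    Continuous (normRpowSmulDeriv s : E → E →L[ℝ] E) := by
  rcases hs.eq_or_lt with rfl | hs
  · have h : (normRpowSmulDeriv 0 : E → E →L[ℝ] E) = fun _ => ContinuousLinearMap.id ℝ E := by
      ext
      simp [normRpowSmulDeriv]
    exact h ▸ continuous_const
  rw [continuous_iff_continuousAt]
  intro x
  by_cases hx : x = 0
  · subst hx
    have hD : normRpowSmulDeriv s (0 : E) = 0 := by
      simp [normRpowSmulDeriv, hs.ne']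
    rw [ContinuousAt, hD]
    have hlim : Tendsto (fun x : E => (1 + s) * ‖x‖ ^ s) (𝓝 0) (𝓝 0) := by
      simpa using (tendsto_norm_rpow_zero (F := E) hs).const_mul (1 + s)
    refine squeeze_zero_norm (fun y => ?_) hlim
    by_cases hy : y = 0
    · subst hy
      rw [hD]
      simp [hs.ne']
    refine ContinuousLinearMap.opNorm_le_bound _ (by positivity) fun v => ?_
    have hpow := norm_rpow_sub_two_mul_sq s hy
    calc ‖normRpowSmulDeriv s y v‖
        ≤ ‖‖y‖ ^ s • v‖ + ‖(s * ‖y‖ ^ (s - 2)) • (⟪y, v⟫ • y)‖ := by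
          simpa [normRpowSmulDeriv] using norm_add_le _ _
      _ = ‖y‖ ^ s * ‖v‖ + s * ‖y‖ ^ (s - 2) * (|⟪y, v⟫| * ‖y‖) := by
          rw [norm_smul, norm_smul, norm_smul, Real.norm_of_nonneg (by positivity),
            Real.norm_of_nonneg (by positivity), Real.norm_eq_abs]
      _ ≤ ‖y‖ ^ s * ‖v‖ + s * ‖y‖ ^ (s - 2) * (‖y‖ * ‖v‖ * ‖y‖) := by
          gcongr
          exact abs_real_inner_le_norm y v
      _ = (1 + s) * ‖y‖ ^ s * ‖v‖ := by
          rw [← hpow]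
          ring
  · have h₁ : ContinuousAt (fun x : E => ‖x‖ ^ s) x :=
      continuousAt_id.norm.rpow_const (.inr hs.le)
    have h₂ : ContinuousAt (fun x : E => ‖x‖ ^ (s - 2)) x :=
      continuousAt_id.norm.rpow_const (.inl (norm_ne_zero_iff.mpr hx))
    have h₃ : Continuous fun x : E => (innerSL ℝ x).smulRight x :=
      (ContinuousLinearMap.smulRightL ℝ E E).continuous₂.comp
        ((innerSL ℝ (E := E)).continuous.prodMk continuous_id)
    exact (h₁.smul continuousAt_const).add ((continuousAt_const.mul h₂).smul h₃.continuousAt)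

lemma contDiff_norm_rpow_smul {s : ℝ} (hs : 0 ≤ s) :
    ContDiff ℝ 1 fun x : E => ‖x‖ ^ s • x :=
  contDiff_one_iff_hasFDerivAt.mpr
    ⟨_, continuous_normRpowSmulDeriv hs, hasFDerivAt_norm_rpow_smul hs⟩

lemma normRpowSmulDeriv_apply_self (s : ℝ) {x : E} (hx : x ≠ 0) :
    normRpowSmulDeriv s x x = ((1 + s) * ‖x‖ ^ s) • x := by
  have hpow := norm_rpow_sub_two_mul_sq s hx
  simp only [normRpowSmulDeriv, add_apply, smul_apply,
    ContinuousLinearMap.id_apply, ContinuousLinearMap.smulRight_apply, innerSL_apply_apply,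
    real_inner_self_eq_norm_sq, smul_smul, ← add_smul, mul_assoc, hpow]
  ring_nf

lemma trace_normRpowSmulDeriv [FiniteDimensional ℝ E] (s : ℝ) {x : E} (hx : x ≠ 0) :
    LinearMap.trace ℝ E (normRpowSmulDeriv s x).toLinearMap =
      (Module.finrank ℝ E + s) * ‖x‖ ^ s := by
  have hpow := norm_rpow_sub_two_mul_sq s hx
  have h : (normRpowSmulDeriv s x).toLinearMap = ‖x‖ ^ s • LinearMap.id +
      (s * ‖x‖ ^ (s - 2)) • (innerSL ℝ x).toLinearMap.smulRight x := rfl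
  rw [h, map_add, map_smul, map_smul, LinearMap.trace_id, LinearMap.trace_smulRight]
  simp only [ContinuousLinearMap.coe_coe, innerSL_apply_apply, real_inner_self_eq_norm_sq,
    smul_eq_mul, mul_assoc, hpow]
  ring

lemma hasGradientAt_sub_norm_sub_rpow_div [CompleteSpace E] {q : ℝ} (hq : 1 < q) (a c : ℝ)
    (x₀ x : E) :
    HasGradientAt (fun y : E => c - ‖y - x₀‖ ^ q / (q * a))
      (-a⁻¹ • (‖x - x₀‖ ^ (q - 2) • (x - x₀))) x := by
  have hq0 : q ≠ 0 := by linarith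
  have h := (((hasFDerivAt_norm_rpow (x - x₀) hq).comp x
    ((hasFDerivAt_id x).sub_const x₀)).mul_const (q * a)⁻¹).const_sub c
  rw [hasGradientAt_iff_hasFDerivAt]
  convert! h using 1
  ext v
  simp
  field_simp

end NormRpowSmul

lemma pLap_sub_norm_sub_rpow_div (p : ℝ) {q : ℝ} (hq : 2 ≤ q) {a : ℝ} (ha : 0 < a) (c : ℝ)
    {x₀ x : Euc n} (hx : x ≠ x₀) :
    pLap p (fun y : Euc n => c - ‖y - x₀‖ ^ q / (q * a)) x =
      -(a⁻¹ ^ (p - 1) * (n + (q - 2) + (p - 2) * (q - 1))) *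
        ‖x - x₀‖ ^ ((q - 1) * (p - 1) - 1) := by
  have hz : x - x₀ ≠ 0 := sub_ne_zero.mpr hx
  have hgrad : gradient (fun y : Euc n => c - ‖y - x₀‖ ^ q / (q * a)) =
      fun x => -a⁻¹ • (‖x - x₀‖ ^ (q - 2) • (x - x₀)) :=
    gradient_eq fun x => hasGradientAt_sub_norm_sub_rpow_div (by linarith) a c x₀ x
  have hfd : fderiv ℝ (fun x : Euc n => -a⁻¹ • (‖x - x₀‖ ^ (q - 2) • (x - x₀))) x =
      -a⁻¹ • normRpowSmulDeriv (q - 2) (x - x₀) :=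
    (((hasFDerivAt_norm_rpow_smul (sub_nonneg.mpr hq) (x - x₀)).comp x
      ((hasFDerivAt_id x).sub_const x₀)).const_smul (-a⁻¹)).fderiv
  rw [pLap, hgrad, hfd]
  have htr := trace_normRpowSmulDeriv (q - 2) hz
  have hself := normRpowSmulDeriv_apply_self (q - 2) hz
  set z := x - x₀
  set D := normRpowSmulDeriv (q - 2) z
  have hN : 0 < ‖z‖ := norm_pos_iff.mpr hz
  have hb : 0 < a⁻¹ := inv_pos.mpr ha
  set b := a⁻¹
  set N := ‖z‖
  have hP : 0 < N ^ (q - 2) := Real.rpow_pos_of_pos hN _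
  have hnorm : ‖-b • (N ^ (q - 2) • z)‖ = b * (N ^ (q - 2) * N) := by
    rw [norm_smul, norm_smul, norm_neg, Real.norm_of_nonneg hb.le, Real.norm_of_nonneg hP.le]
  have htrace : LinearMap.trace ℝ (Euc n) (-b • D).toLinearMap =
      -b * ((n + (q - 2)) * N ^ (q - 2)) := by
    rw [ContinuousLinearMap.toLinearMap_smul, map_smul, htr, finrank_euclideanSpace_fin,
      smul_eq_mul]
  have hinner : ⟪(-b • D) (-b • (N ^ (q - 2) • z)), -b • (N ^ (q - 2) • z)⟫ =
      -b * ((q - 1) * N ^ (q - 2)) * (b * (N ^ (q - 2) * N)) ^ 2 := by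
    rw [smul_apply, map_smul, map_smul, hself]
    simp only [real_inner_smul_left, real_inner_smul_right, real_inner_self_eq_norm_sq]
    ring
  have hpow : (b * (N ^ (q - 2) * N)) ^ (p - 2) * (b * N ^ (q - 2)) =
      b ^ (p - 1) * N ^ ((q - 1) * (p - 1) - 1) := by
    have h₁ : N ^ (q - 2) * N = N ^ (q - 1) := by
      rw [← Real.rpow_add_one hN.ne']
      ring_nf
    rw [h₁, Real.mul_rpow hb.le (by positivity), ← Real.rpow_mul hN.le,
      mul_mul_mul_comm, ← Real.rpow_add_one hb.ne', ← Real.rpow_add hN]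
    ring_nf
  have hne : b * (N ^ (q - 2) * N) ≠ 0 := by positivity
  rw [hnorm, htrace, hinner, mul_comm (-b * _), ← mul_assoc (_ / _),
    div_mul_cancel₀ _ (pow_ne_zero 2 hne)]
  linear_combination -(n + (q - 2) + (p - 2) * (q - 1)) * hpow

/-- **The kernel test function.** For `q ≥ 2` with `q > p/(p-1)`, the function
`ψ(y) = c - |y - xhat|^q/(q ε^(q-1))` is `C²`, has nonvanishing gradient away from `xhat`, and
`sup_(B_r(xhat) \ {xhat}) |Δ_p ψ| → 0` as `r → 0⁺`. -/
theorem pLap_of_infConv_kernel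
    (n : ℕ) (p : ℝ) (hp : 1 < p) (q : ℝ) (hq2 : 2 ≤ q) (hq : p / (p - 1) < q)
    (ε : ℝ) (hε : 0 < ε) (xhat : Euc n) (c : ℝ) :
    ContDiff ℝ 2 (fun y : Euc n => c - ‖y - xhat‖ ^ q / (q * ε ^ (q - 1))) ∧
    (∀ y : Euc n, y ≠ xhat →
      gradient (fun y : Euc n => c - ‖y - xhat‖ ^ q / (q * ε ^ (q - 1))) y ≠ 0) ∧
    (∀ ρ > (0 : ℝ), ∃ r₀ > (0 : ℝ), ∀ y ∈ ball xhat r₀ \ {xhat},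
      |pLap p (fun y : Euc n => c - ‖y - xhat‖ ^ q / (q * ε ^ (q - 1))) y| ≤ ρ) := by
  have hq1 : 1 < q := by linarith
  have ha : 0 < ε ^ (q - 1) := Real.rpow_pos_of_pos hε _
  have hgrad := hasGradientAt_sub_norm_sub_rpow_div hq1 (ε ^ (q - 1)) c xhat
  refine ⟨?_, fun y hy => ?_, fun ρ hρ => ?_⟩
  · refine (contDiff_succ_iff_hasFDerivAt (n := 1)).mpr
      ⟨_, ?_, fun x => (hgrad x).hasFDerivAt⟩
    exact (InnerProductSpace.toDual ℝ (Euc n)).contDiff.comp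
      (((contDiff_norm_rpow_smul (sub_nonneg.mpr hq2)).comp
        (contDiff_id.sub contDiff_const)).const_smul _)
  · rw [(hgrad y).gradient]
    have hz : y - xhat ≠ 0 := sub_ne_zero.mpr hy
    have hN : 0 < ‖y - xhat‖ := norm_pos_iff.mpr hz
    exact smul_ne_zero (neg_ne_zero.mpr (inv_pos.mpr ha).ne')
      (smul_ne_zero (Real.rpow_pos_of_pos hN _).ne' hz)
  · have hexp : 0 < (q - 1) * (p - 1) - 1 := by
      rw [div_lt_iff₀ (by linarith)] at hq
      linarith
    set K := -((ε ^ (q - 1))⁻¹ ^ (p - 1) * (n + (q - 2) + (p - 2) * (q - 1)))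
    have hlim : Tendsto (fun z : Euc n => K * ‖z‖ ^ ((q - 1) * (p - 1) - 1)) (𝓝 0) (𝓝 0) := by
      simpa using (tendsto_norm_rpow_zero (F := Euc n) hexp).const_mul K
    obtain ⟨r₀, hr₀, h⟩ := Metric.tendsto_nhds_nhds.mp hlim ρ hρ
    refine ⟨r₀, hr₀, fun y ⟨hy, hne⟩ => ?_⟩
    rw [pLap_sub_norm_sub_rpow_div p hq2 ha c hne]
    have := h (x := y - xhat) (by simpa [dist_eq_norm] using hy)
    rw [Real.dist_eq, sub_zero] at this
    exact this.le

end
end
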